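/- arXiv:1610.02766 — 2 statements merged into one kernel-verified Lean document; each statement's English description precedes it below -/
import Mathlib

section
/- There exists a universal constant C₄ > 0 such that for every k ≥ 1, K = 2^k, every N with K^m ≤ N < K^{m+1}, every 0 ≤ j ≤ m−1, and all x, y ∈ V_N, one has E[η_j(x) η_j(y)] ≥ −C₄. -/
open MeasureTheory ProbabilityTheory Real Set Filter

/-- The lattice ℤ². -/
abbrev Z2 := ℤ × ℤ

/-- Nearest-neighbor adjacency on ℤ². -/
def Adj (x y : Z2) : Prop := |x.1 - y.1| + |x.2 - y.2| = 1

/-- The `L^∞` distance on ℤ². -/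
def linf (x y : Z2) : ℤ := max |x.1 - y.1| |x.2 - y.2|

/-- The Euclidean distance on ℤ². -/
noncomputable def eZ (x y : Z2) : ℝ :=
  Real.sqrt (((x.1 - y.1 : ℤ) : ℝ) ^ 2 + ((x.2 - y.2 : ℤ) : ℝ) ^ 2)

/-- Inner boundary `∂B` of a set `B ⊆ ℤ²`: points of `B` having a nearest neighbor
outside `B`. -/
def bdry (B : Set Z2) : Set Z2 := {z | z ∈ B ∧ ∃ w, Adj z w ∧ w ∉ B}

/-- Number of nearest-neighbor paths of length `t` from `x` to `y` avoiding `∂B`. -/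
noncomputable def nWalks (B : Set Z2) (t : ℕ) (x y : Z2) : ℕ :=
  Nat.card {f : Fin (t + 1) → Z2 //
    f 0 = x ∧ f (Fin.last t) = y ∧ (∀ i, f i ∉ bdry B) ∧
    ∀ i : Fin t, Adj (f i.castSucc) (f i.succ)}

/-- The Green function of simple random walk on ℤ² killed upon hitting `∂B`:
`G_B(x,y) = E_x [∑_{t=0}^{τ-1} 1_{S_t = y}]`, where `τ` is the hitting time of `∂B`. -/
noncomputable def greenFn (B : Set Z2) (x y : Z2) : ℝ :=
  ∑' t : ℕ, (1 / 4 : ℝ) ^ t * nWalks B t x y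

/-- A centered (jointly) Gaussian family: every finite linear combination is a
centered Gaussian random variable. -/
def IsCenteredGaussianFamily {Ω : Type*} [MeasureSpace Ω] {ι : Type*} (f : ι → Ω → ℝ) : Prop :=
  ∀ (s : Finset ι) (c : ι → ℝ), ∃ v : NNReal,
    Measure.map (fun ω => ∑ i ∈ s, c i * f i ω) (ℙ : Measure Ω) = gaussianReal 0 v

/-- `η` is a discrete Gaussian free field on `B` with Dirichlet boundary conditions:
a centered Gaussian field, vanishing outside `B`, whose covariance on `B` is the
Green function of simple random walk killed at `∂B`. -/
def IsDGFF {Ω : Type*} [MeasureSpace Ω] (B : Set Z2) (η : Z2 → Ω → ℝ) : Prop :=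
  IsCenteredGaussianFamily (fun z : Z2 => η z) ∧
  (∀ z, z ∉ B → η z = 0) ∧
  (∀ x ∈ B, ∀ y ∈ B, ∫ ω, η x ω * η y ω = greenFn B x y)

/-- `F` is the harmonic extension of `η` from outside `B`: it agrees with `η` on
`B^c ∪ ∂B` and is discrete harmonic on `B ∖ ∂B`. -/
def IsHarmExt {Ω : Type*} [MeasureSpace Ω] (η F : Z2 → Ω → ℝ) (B : Set Z2) : Prop :=
  (∀ z, z ∉ B \ bdry B → F z = η z) ∧
  (∀ z ∈ B \ bdry B, ∀ ω, 4 * F z ω =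
    F (z.1 + 1, z.2) ω + F (z.1 - 1, z.2) ω + F (z.1, z.2 + 1) ω + F (z.1, z.2 - 1) ω)

/-- The box of side length `ℓ` centered at `x`. -/
def boxZ (x : Z2) (ℓ : ℤ) : Set Z2 :=
  {z | x.1 - ℓ / 2 ≤ z.1 ∧ z.1 ≤ x.1 + ℓ / 2 ∧ x.2 - ℓ / 2 ≤ z.2 ∧ z.2 ≤ x.2 + ℓ / 2}

/-- `V_N = [0,N)² ∩ ℤ²`. -/
def VN (N : ℕ) : Set Z2 := {z | 0 ≤ z.1 ∧ z.1 < (N : ℤ) ∧ 0 ≤ z.2 ∧ z.2 < (N : ℤ)}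

/-- `V_{5N} = [-2N, 3N)² ∩ ℤ²`. -/
def V5N (N : ℕ) : Set Z2 :=
  {z | -(2 * (N : ℤ)) ≤ z.1 ∧ z.1 < 3 * (N : ℤ) ∧ -(2 * (N : ℤ)) ≤ z.2 ∧ z.2 < 3 * (N : ℤ)}

/-- The field `η_j`: `η_0 = η^{V_{5N}} - H_K` and `η_j = H_{K^j} - H_{K^{j+1}}` for
`j ≥ 1`, where `H ℓ x` denotes the value at `x` of the harmonic extension of the
field `η` from outside the box of side `ℓ` centered at `x`. -/
def etaJ {Ω : Type*} (η : Z2 → Ω → ℝ) (H : ℤ → Z2 → Ω → ℝ) (K : ℕ) (j : ℕ) (x : Z2) :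
    Ω → ℝ :=
  if j = 0 then fun ω => η x ω - H (K : ℤ) x ω
  else fun ω => H ((K : ℤ) ^ j) x ω - H ((K : ℤ) ^ (j + 1)) x ω

/-- A path in `V` given as a nonempty list of vertices of `V` in which consecutive
vertices are nearest neighbors. -/
def LPathIn (V : Set Z2) (P : List Z2) : Prop :=
  P ≠ [] ∧ P.Chain' Adj ∧ ∀ z ∈ P, z ∈ V

/-- Sum of a function over the four nearest neighbors. -/
def nsum {E : Type*} [AddCommMonoid E] (f : Z2 → E) (z : Z2) : E :=
  f (z.1 + 1, z.2) + f (z.1 - 1, z.2) + f (z.1, z.2 + 1) + f (z.1, z.2 - 1)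

/-- All four neighbors of `z` are in `B`. -/
def NbrIn (B : Set Z2) (z : Z2) : Prop :=
  (z.1 + 1, z.2) ∈ B ∧ (z.1 - 1, z.2) ∈ B ∧ (z.1, z.2 + 1) ∈ B ∧ (z.1, z.2 - 1) ∈ B

/-- Discrete minimum principle. -/
lemma min_principle (D B : Set Z2) (hB : B.Finite) (hsub : D ⊆ B)
    (hD : ∀ z ∈ D, NbrIn B z) (f : Z2 → ℝ)
    (hs : ∀ z ∈ D, nsum f z ≤ 4 * f z) (hb : ∀ z ∈ B, z ∉ D → 0 ≤ f z) :
    ∀ z ∈ B, 0 ≤ f z := by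
  intro z0 hz0
  by_contra! hneg
  obtain ⟨z, hz, hmin⟩ := hB.toFinset.exists_min_image
    (fun z => toLex (f z, - z.1)) ⟨z0, by simpa using hz0⟩
  have hzB : z ∈ B := by simpa using hz
  have hle : ∀ w ∈ B, f z ≤ f w ∧ (f w = f z → w.1 ≤ z.1) := by
    intro w hw
    have h := hmin w (by simpa using hw)
    rw [Prod.Lex.toLex_le_toLex] at h
    rcases h with h | ⟨h1, h2⟩
    · exact ⟨h.le, fun h' => absurd h (by simp at h ⊢; linarith)⟩
    · simp at h1 h2
      exact ⟨h1.le, fun _ => h2⟩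
  have hzD : z ∈ D := by
    by_contra hzD
    have := hb z hzB hzD
    have := (hle z0 hz0).1
    linarith
  obtain ⟨h1, h2, h3, h4⟩ := hD z hzD
  have e1 := hle _ h1
  have e2 := hle _ h2
  have e3 := hle _ h3
  have e4 := hle _ h4
  have := hs z hzD
  unfold nsum at this
  have h5 : f (z.1 + 1, z.2) = f z := by linarith [e1.1, e2.1, e3.1, e4.1]
  have := e1.2 h5
  simp at this

/-- Uniqueness for vector-valued harmonic functions. -/
lemma harm_unique {E : Type*} [AddCommGroup E] [Module ℝ E] (D B : Set Z2) (hB : B.Finite)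
    (hsub : D ⊆ B) (hD : ∀ z ∈ D, NbrIn B z) (f : Z2 → E)
    (hs : ∀ z ∈ D, nsum f z = (4 : ℝ) • f z) (hb : ∀ z, z ∉ D → f z = 0) :
    ∀ z, f z = 0 := by
  intro z
  by_cases hzD : z ∉ D
  · exact hb z hzD
  push Not at hzD
  rw [← Module.forall_dual_apply_eq_zero_iff ℝ]
  intro l
  have key : ∀ l : Module.Dual ℝ E, 0 ≤ l (f z) := by
    intro l
    refine min_principle D B hB hsub hD (fun z => l (f z)) ?_ ?_ z (hsub hzD)
    · intro z hz
      have := congrArg l (hs z hz)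
      simp only [nsum, map_add, map_smul, smul_eq_mul] at this ⊢
      exact this.le
    · intro z _ hz
      simp [hb z hz]
  have h1 := key l
  have h2 := key (-l)
  simp at h2
  linarith

/-- Squared Euclidean distance plus one. -/
noncomputable def qd (z w : Z2) : ℝ := ((z.1 : ℝ) - w.1) ^ 2 + ((z.2 : ℝ) - w.2) ^ 2 + 1

lemma qd_pos (z w : Z2) : 0 < qd z w := by unfold qd; positivity

lemma qd_symm (z w : Z2) : qd z w = qd w z := by unfold qd; ring

/-- The logarithmic barrier. -/
noncomputable def barrier (M : ℝ) (w z : Z2) : ℝ := Real.log (M / qd z w) / Real.log 2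

lemma barrier_nonneg (M : ℝ) (w z : Z2) (h : qd z w ≤ M) : 0 ≤ barrier M w z := by
  unfold barrier
  have : 1 ≤ M / qd z w := (one_le_div (qd_pos z w)).2 h
  exact div_nonneg (Real.log_nonneg this) (Real.log_nonneg (by norm_num))

lemma barrier_super (M : ℝ) (hM : 0 < M) (w z : Z2) :
    nsum (barrier M w) z + 4 * (if z = w then 1 else 0) ≤ 4 * barrier M w z := by
  have hl2 : 0 < Real.log 2 := Real.log_pos (by norm_num)
  have hb : ∀ z, barrier M w z = (Real.log M - Real.log (qd z w)) / Real.log 2 := by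
    intro z
    unfold barrier
    rw [Real.log_div hM.ne' (qd_pos z w).ne']
  have hlog : 4 * Real.log (qd z w) + 4 * (if z = w then 1 else 0) * Real.log 2 ≤
      Real.log (qd (z.1 + 1, z.2) w) + Real.log (qd (z.1 - 1, z.2) w)
      + Real.log (qd (z.1, z.2 + 1) w) + Real.log (qd (z.1, z.2 - 1) w) := by
    have p1 := qd_pos (z.1 + 1, z.2) w
    have p2 := qd_pos (z.1 - 1, z.2) w
    have p3 := qd_pos (z.1, z.2 + 1) w
    have p4 := qd_pos (z.1, z.2 - 1) w
    rw [← Real.log_mul p1.ne' p2.ne', ← Real.log_mul (by positivity) p3.ne',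
      ← Real.log_mul (by positivity) p4.ne']
    by_cases h : z = w
    · subst h
      simp [qd]
      norm_num
      have : (16 : ℝ) = 2 ^ 4 := by norm_num
      rw [this, Real.log_pow]
      norm_num
    · simp only [h, if_false, mul_zero, zero_mul, add_zero]
      have h4 : 4 * Real.log (qd z w) = Real.log (qd z w ^ 4) := by
        rw [Real.log_pow]; norm_num
      rw [h4]
      apply Real.log_le_log (pow_pos (qd_pos z w) 4)
      unfold qd
      push_cast
      obtain ⟨x, hx⟩ : ∃ x : ℝ, x = (z.1 : ℝ) - w.1 := ⟨_, rfl⟩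
      obtain ⟨y, hy⟩ : ∃ y : ℝ, y = (z.2 : ℝ) - w.2 := ⟨_, rfl⟩
      have a1 : (z.1 : ℝ) + 1 - w.1 = x + 1 := by rw [hx]; ring
      have a2 : (z.1 : ℝ) - 1 - w.1 = x - 1 := by rw [hx]; ring
      have a3 : (z.2 : ℝ) + 1 - w.2 = y + 1 := by rw [hy]; ring
      have a4 : (z.2 : ℝ) - 1 - w.2 = y - 1 := by rw [hy]; ring
      rw [a1, a2, a3, a4, ← hx, ← hy, ← sub_nonneg]
      have key : ((x + 1) ^ 2 + y ^ 2 + 1) * ((x - 1) ^ 2 + y ^ 2 + 1) * (x ^ 2 + (y + 1) ^ 2 + 1) *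
          (x ^ 2 + (y - 1) ^ 2 + 1) - (x ^ 2 + y ^ 2 + 1) ^ 4 =
          2 * (x ^ 2 + y ^ 2 + 1) ^ 2 + 8 * (x ^ 2 + y ^ 2 + 1) + 5 + 16 * x ^ 2 * y ^ 2 := by ring
      rw [key]
      positivity
  simp only [nsum, hb]
  rw [← sub_nonneg]
  have : 4 * ((Real.log M - Real.log (qd z w)) / Real.log 2) -
      ((Real.log M - Real.log (qd (z.1 + 1, z.2) w)) / Real.log 2 +
      (Real.log M - Real.log (qd (z.1 - 1, z.2) w)) / Real.log 2 +
      (Real.log M - Real.log (qd (z.1, z.2 + 1) w)) / Real.log 2 +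
      (Real.log M - Real.log (qd (z.1, z.2 - 1) w)) / Real.log 2 +
      4 * (if z = w then 1 else 0)) =
      (Real.log (qd (z.1 + 1, z.2) w) + Real.log (qd (z.1 - 1, z.2) w)
      + Real.log (qd (z.1, z.2 + 1) w) + Real.log (qd (z.1, z.2 - 1) w) -
      (4 * Real.log (qd z w) + 4 * (if z = w then 1 else 0) * Real.log 2)) / Real.log 2 := by
    field_simp
    ring
  rw [this]
  exact div_nonneg (by linarith) hl2.le

/-- The four neighbors, indexed by `Fin 4`. -/
def nb (z : Z2) : Fin 4 → Z2 :=
  ![(z.1 + 1, z.2), (z.1 - 1, z.2), (z.1, z.2 + 1), (z.1, z.2 - 1)]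

lemma nb_inj (z : Z2) : Function.Injective (nb z) := by
  intro i j h
  fin_cases i <;> fin_cases j <;> simp [nb, Prod.ext_iff] at h ⊢ <;> omega

lemma adj_iff (z w : Z2) : Adj z w ↔ ∃ i, w = nb z i := by
  constructor
  · intro h
    obtain ⟨a, b⟩ := z
    obtain ⟨c, d⟩ := w
    simp only [Adj] at h
    have h' : (c = a + 1 ∧ d = b) ∨ (c = a - 1 ∧ d = b) ∨ (c = a ∧ d = b + 1) ∨
        (c = a ∧ d = b - 1) := by
      rcases abs_cases (a - c) with h1 | h1 <;> rcases abs_cases (b - d) with h2 | h2 <;> omega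
    rcases h' with ⟨rfl, rfl⟩ | ⟨rfl, rfl⟩ | ⟨rfl, rfl⟩ | ⟨rfl, rfl⟩
    · exact ⟨0, rfl⟩
    · exact ⟨1, rfl⟩
    · exact ⟨2, rfl⟩
    · exact ⟨3, rfl⟩
  · rintro ⟨i, rfl⟩
    fin_cases i <;> simp [nb, Adj]

/-- The type of walks counted by `nWalks`. -/
abbrev Wk (B : Set Z2) (t : ℕ) (x y : Z2) : Type :=
  {f : Fin (t + 1) → Z2 //
    f 0 = x ∧ f (Fin.last t) = y ∧ (∀ i, f i ∉ bdry B) ∧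
    ∀ i : Fin t, Adj (f i.castSucc) (f i.succ)}

/-- Prepend a step to a walk. -/
def wcons (B : Set Z2) (t : ℕ) (z w : Z2) (hz : z ∉ bdry B) :
    (Σ i : Fin 4, Wk B t (nb z i) w) → Wk B (t + 1) z w := fun p =>
  ⟨Fin.cons z p.2.1, by
    obtain ⟨i, f, h0, h1, h2, h3⟩ := p
    refine ⟨rfl, ?_, ?_, ?_⟩
    · rw [← Fin.succ_last]
      simpa using h1
    · intro k
      refine Fin.cases ?_ ?_ k
      · simpa using hz
      · intro k
        simpa using h2 k
    · intro k
      refine Fin.cases ?_ ?_ k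
      · rw [Fin.castSucc_zero, Fin.cons_zero, Fin.cons_succ]
        exact (adj_iff _ _).2 ⟨i, h0⟩
      · intro k
        have := h3 k
        rw [Fin.cons_succ, ← Fin.succ_castSucc, Fin.cons_succ]
        exact this⟩

lemma wcons_bij (B : Set Z2) (t : ℕ) (z w : Z2) (hz : z ∉ bdry B) :
    Function.Bijective (wcons B t z w hz) := by
  constructor
  · rintro ⟨i, f, hf⟩ ⟨i', f', hf'⟩ h
    have h1 := congrArg Subtype.val h
    simp only [wcons] at h1
    have h2 : f = f' := Fin.cons_right_injective (α := fun _ => Z2) z h1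
    subst h2
    have : i = i' := nb_inj z (hf.1.symm.trans hf'.1)
    subst this
    rfl
  · rintro ⟨f, h0, h1, h2, h3⟩
    have ha := h3 0
    rw [Fin.castSucc_zero, h0] at ha
    obtain ⟨i, hi⟩ := (adj_iff _ _).1 ha
    refine ⟨⟨i, Fin.tail f, ?_, ?_, ?_, ?_⟩, ?_⟩
    · exact hi
    · exact h1
    · intro k
      exact h2 _
    · intro k
      exact h3 k.succ
    · apply Subtype.ext
      simp only [wcons]
      rw [← h0]
      exact Fin.cons_self_tail f

lemma wk_empty (B : Set Z2) (t : ℕ) (z w : Z2) (hz : z ∈ bdry B) : IsEmpty (Wk B t z w) := by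
  constructor
  rintro ⟨f, h0, h1, h2, h3⟩
  exact h2 0 (h0 ▸ hz)

lemma wk_finite (B : Set Z2) (t : ℕ) : ∀ z w : Z2, Finite (Wk B t z w) := by
  induction t with
  | zero =>
    intro z w
    have : Subsingleton (Wk B 0 z w) := by
      constructor
      rintro ⟨f, hf⟩ ⟨g, hg⟩
      apply Subtype.ext
      funext i
      have : i = 0 := by apply Fin.ext; omega
      subst this
      simp [hf.1, hg.1]
    infer_instance
  | succ t ih =>
    intro z w
    by_cases hz : z ∈ bdry B
    · have := wk_empty B (t + 1) z w hz
      infer_instance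
    · have := fun i => ih (nb z i) w
      exact Finite.of_surjective _ (wcons_bij B t z w hz).2

lemma nWalks_bdry (B : Set Z2) (t : ℕ) (z w : Z2) (hz : z ∈ bdry B) : nWalks B t z w = 0 := by
  have := wk_empty B t z w hz
  exact Nat.card_of_isEmpty (α := Wk B t z w)

lemma nWalks_succ (B : Set Z2) (t : ℕ) (z w : Z2) (hz : z ∉ bdry B) :
    nWalks B (t + 1) z w = nsum (fun z' => nWalks B t z' w) z := by
  have h1 : nWalks B (t + 1) z w = Nat.card (Σ i : Fin 4, Wk B t (nb z i) w) :=
    (Nat.card_eq_of_bijective _ (wcons_bij B t z w hz)).symm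
  have := fun i => wk_finite B t (nb z i) w
  rw [h1, Nat.card_sigma, Fin.sum_univ_four]
  rfl

lemma nWalks_zero (B : Set Z2) (z w : Z2) (hz : z ∉ bdry B) :
    nWalks B 0 z w = if z = w then 1 else 0 := by
  split_ifs with h
  · subst h
    have : Unique (Wk B 0 z z) :=
      { default := ⟨fun _ => z, rfl, rfl, fun _ => hz, fun i => i.elim0⟩
        uniq := by
          rintro ⟨f, hf⟩
          apply Subtype.ext
          funext i
          have : i = 0 := by apply Fin.ext; omega
          subst this
          exact hf.1 }
    exact Nat.card_unique (α := Wk B 0 z z)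
  · have : IsEmpty (Wk B 0 z w) := by
      constructor
      rintro ⟨f, h0, h1, _⟩
      exact h (h0.symm.trans h1)
    exact Nat.card_of_isEmpty (α := Wk B 0 z w)

lemma nbrIn_of_not_bdry (B : Set Z2) (z : Z2) (hz : z ∈ B) (h : z ∉ bdry B) : NbrIn B z := by
  have : ∀ i, nb z i ∈ B := by
    intro i
    by_contra hi
    exact h ⟨hz, _, (adj_iff _ _).2 ⟨i, rfl⟩, hi⟩
  exact ⟨this 0, this 1, this 2, this 3⟩

lemma green_partial_le (B : Set Z2) (M : ℝ) (hM : ∀ z ∈ B, ∀ w ∈ B, qd z w ≤ M) (w : Z2)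
    (hw : w ∈ B) (T : ℕ) : ∀ z ∈ B,
    ∑ t ∈ Finset.range T, (1 / 4 : ℝ) ^ t * nWalks B t z w ≤ barrier M w z := by
  have hM0 : 0 < M := (qd_pos w w).trans_le (hM w hw w hw)
  induction T with
  | zero =>
    intro z hz
    simpa using barrier_nonneg M w z (hM z hz w hw)
  | succ T ih =>
    intro z hz
    by_cases hb : z ∈ bdry B
    · simp only [nWalks_bdry B _ z w hb]
      simpa using barrier_nonneg M w z (hM z hz w hw)
    · rw [Finset.sum_range_succ']
      obtain ⟨n1, n2, n3, n4⟩ := nbrIn_of_not_bdry B z hz hb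
      have e1 := ih _ n1
      have e2 := ih _ n2
      have e3 := ih _ n3
      have e4 := ih _ n4
      have hsup := barrier_super M hM0 w z
      have hr : ∑ t ∈ Finset.range T, (1 / 4 : ℝ) ^ (t + 1) * nWalks B (t + 1) z w =
          (1 / 4) * nsum (fun z' => ∑ t ∈ Finset.range T, (1 / 4 : ℝ) ^ t * nWalks B t z' w) z := by
        simp only [nsum]
        rw [← Finset.sum_add_distrib, ← Finset.sum_add_distrib, ← Finset.sum_add_distrib,
          Finset.mul_sum]
        apply Finset.sum_congr rfl
        intro t _
        rw [nWalks_succ B t z w hb]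
        simp only [nsum]
        push_cast
        ring
      rw [hr, nWalks_zero B z w hb]
      simp only [nsum] at hsup ⊢
      push_cast
      linarith

lemma green_summable (B : Set Z2) (M : ℝ) (hM : ∀ z ∈ B, ∀ w ∈ B, qd z w ≤ M) (z w : Z2)
    (hz : z ∈ B) (hw : w ∈ B) : Summable (fun t : ℕ => (1 / 4 : ℝ) ^ t * nWalks B t z w) :=
  summable_of_sum_range_le (fun t => by positivity)
    (fun T => green_partial_le B M hM w hw T z hz)

lemma green_rec (B : Set Z2) (M : ℝ) (hM : ∀ z ∈ B, ∀ w ∈ B, qd z w ≤ M) (z w : Z2)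
    (hz : z ∈ B) (hw : w ∈ B) (hb : z ∉ bdry B) :
    4 * greenFn B z w = nsum (fun z' => greenFn B z' w) z + 4 * (if z = w then 1 else 0) := by
  obtain ⟨n1, n2, n3, n4⟩ := nbrIn_of_not_bdry B z hz hb
  have s := green_summable B M hM z w hz hw
  have s1 := green_summable B M hM _ w n1 hw
  have s2 := green_summable B M hM _ w n2 hw
  have s3 := green_summable B M hM _ w n3 hw
  have s4 := green_summable B M hM _ w n4 hw
  have h0 : greenFn B z w = _ := s.tsum_eq_zero_add
  have hs := (((s1.hasSum.add s2.hasSum).add s3.hasSum).add s4.hasSum).mul_left (1 / 4)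
  have : ∑' t : ℕ, (1 / 4 : ℝ) ^ (t + 1) * nWalks B (t + 1) z w =
      1 / 4 * nsum (fun z' => greenFn B z' w) z := by
    refine Eq.trans ?_ hs.tsum_eq
    apply tsum_congr
    intro t
    rw [nWalks_succ B t z w hb]
    simp only [nsum]
    push_cast
    ring
  rw [h0, this, nWalks_zero B z w hb]
  push_cast
  ring

/-- Open box of radius `r`. -/
def oBox (x : Z2) (r : ℤ) : Set Z2 :=
  {z | x.1 - r < z.1 ∧ z.1 < x.1 + r ∧ x.2 - r < z.2 ∧ z.2 < x.2 + r}

/-- Closed box of radius `r`. -/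
def cBox (x : Z2) (r : ℤ) : Set Z2 :=
  {z | x.1 - r ≤ z.1 ∧ z.1 ≤ x.1 + r ∧ x.2 - r ≤ z.2 ∧ z.2 ≤ x.2 + r}

lemma cBox_finite (x : Z2) (r : ℤ) : (cBox x r).Finite := by
  refine (Set.finite_Icc (x.1 - r, x.2 - r) (x.1 + r, x.2 + r)).subset ?_
  rintro z ⟨h1, h2, h3, h4⟩
  exact ⟨⟨h1, h3⟩, ⟨h2, h4⟩⟩

lemma oBox_sub (x : Z2) (r : ℤ) : oBox x r ⊆ cBox x r := by
  rintro z ⟨h1, h2, h3, h4⟩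
  exact ⟨h1.le, h2.le, h3.le, h4.le⟩

lemma oBox_nbr (x : Z2) (r : ℤ) : ∀ z ∈ oBox x r, NbrIn (cBox x r) z := by
  rintro z ⟨h1, h2, h3, h4⟩
  refine ⟨⟨?_, ?_, ?_, ?_⟩, ⟨?_, ?_, ?_, ?_⟩, ⟨?_, ?_, ?_, ?_⟩, ⟨?_, ?_, ?_, ?_⟩⟩ <;>
    simp only <;> omega

lemma box_min (x : Z2) (r : ℤ) (f : Z2 → ℝ)
    (hs : ∀ z ∈ oBox x r, nsum f z ≤ 4 * f z) (hb : ∀ z ∈ cBox x r, z ∉ oBox x r → 0 ≤ f z) :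
    ∀ z ∈ cBox x r, 0 ≤ f z :=
  min_principle _ _ (cBox_finite x r) (oBox_sub x r) (oBox_nbr x r) f hs hb

lemma boxZ_eq (x : Z2) (l : ℤ) : boxZ x l = cBox x (l / 2) := rfl

lemma box_diff (x : Z2) (r : ℤ) : cBox x r \ bdry (cBox x r) = oBox x r := by
  ext z
  constructor
  · rintro ⟨h, h'⟩
    obtain ⟨h1, h2, h3, h4⟩ := nbrIn_of_not_bdry _ _ h h'
    simp only [cBox, oBox, Set.mem_ofPred_eq] at *
    omega
  · intro h
    refine ⟨oBox_sub x r h, ?_⟩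
    rintro ⟨_, w, hw, hw'⟩
    obtain ⟨i, rfl⟩ := (adj_iff _ _).1 hw
    obtain ⟨n1, n2, n3, n4⟩ := oBox_nbr x r z h
    apply hw'
    fin_cases i
    · exact n1
    · exact n2
    · exact n3
    · exact n4

/-- The universal constant. -/
noncomputable def cst : ℝ := Real.log 72 / Real.log 2

section core
variable {Ω : Type} [MeasureSpace Ω]

/-- Square-integrable functions as a submodule. -/
def l2sub (Ω : Type) [MeasureSpace Ω] : Submodule ℝ (Ω → ℝ) where
  carrier := {f | MemLp f 2 (ℙ : Measure Ω)}
  add_mem' := fun h1 h2 => MemLp.add h1 h2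
  zero_mem' := MemLp.zero
  smul_mem' := fun c _ h => MemLp.const_smul h c

/-- `F` is the harmonic extension of `η` from outside the open box. -/
def HE (η F : Z2 → Ω → ℝ) (x : Z2) (r : ℤ) : Prop :=
  (∀ z, z ∉ oBox x r → F z = η z) ∧ (∀ z ∈ oBox x r, (4 : ℝ) • F z = nsum F z)

lemma HE.memLp {η F : Z2 → Ω → ℝ} {x : Z2} {r : ℤ} (h : HE η F x r)
    (hη : ∀ z, MemLp (η z) 2 (ℙ : Measure Ω)) (z : Z2) : MemLp (F z) 2 (ℙ : Measure Ω) := by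
  have := harm_unique (oBox x r) (cBox x r) (cBox_finite x r) (oBox_sub x r) (oBox_nbr x r)
    (fun z => (l2sub Ω).mkQ (F z)) ?_ ?_ z
  · rw [Submodule.mkQ_apply, Submodule.Quotient.mk_eq_zero] at this
    exact this
  · intro z hz
    rw [← map_smul, h.2 z hz]
    simp only [nsum, map_add]
  · intro z hz
    rw [Submodule.mkQ_apply, Submodule.Quotient.mk_eq_zero, h.1 z hz]
    exact hη z

lemma int_add {u f g : Ω → ℝ} (hu : MemLp u 2 (ℙ : Measure Ω)) (hf : MemLp f 2 (ℙ : Measure Ω))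
    (hg : MemLp g 2 (ℙ : Measure Ω)) :
    ∫ ω, u ω * (f + g) ω = (∫ ω, u ω * f ω) + ∫ ω, u ω * g ω := by
  refine Eq.trans ?_ (integral_add (hu.integrable_mul hf) (hu.integrable_mul hg))
  congr 1
  funext ω
  simp [mul_add]

lemma int_sub {u f g : Ω → ℝ} (hu : MemLp u 2 (ℙ : Measure Ω)) (hf : MemLp f 2 (ℙ : Measure Ω))
    (hg : MemLp g 2 (ℙ : Measure Ω)) :
    ∫ ω, u ω * (f - g) ω = (∫ ω, u ω * f ω) - ∫ ω, u ω * g ω := by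
  refine Eq.trans ?_ (integral_sub (hu.integrable_mul hf) (hu.integrable_mul hg))
  congr 1
  funext ω
  simp [mul_sub]

lemma int_comm (u f : Ω → ℝ) : ∫ ω, u ω * f ω = ∫ ω, f ω * u ω := by
  congr 1
  funext ω
  ring

/-- The pairing with a fixed variable is harmonic. -/
lemma HE.pair {η F : Z2 → Ω → ℝ} {x : Z2} {r : ℤ} (h : HE η F x r)
    (hη : ∀ z, MemLp (η z) 2 (ℙ : Measure Ω)) {u : Ω → ℝ} (hu : MemLp u 2 (ℙ : Measure Ω))
    (z : Z2) (hz : z ∈ oBox x r) :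
    4 * (∫ ω, u ω * F z ω) = nsum (fun z => ∫ ω, u ω * F z ω) z := by
  have hF := h.memLp hη
  have e := h.2 z hz
  have : 4 * (∫ ω, u ω * F z ω) = ∫ ω, u ω * ((4 : ℝ) • F z) ω := by
    rw [← integral_const_mul]
    congr 1
    funext ω
    simp
    ring
  rw [this, e]
  simp only [nsum]
  rw [int_add hu (((hF _).add (hF _)).add (hF _)) (hF _), int_add hu ((hF _).add (hF _)) (hF _),
    int_add hu (hF _) (hF _)]

/-- The Green function of the box, as a covariance. -/
noncomputable def gB (η F : Z2 → Ω → ℝ) (w z : Z2) : ℝ :=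
  (∫ ω, η w ω * η z ω) - ∫ ω, η w ω * F z ω

lemma gB_out {η F : Z2 → Ω → ℝ} {x : Z2} {r : ℤ} (h : HE η F x r) (w z : Z2)
    (hz : z ∉ oBox x r) : gB η F w z = 0 := by
  unfold gB
  rw [h.1 z hz, sub_self]

lemma gB_in {η F : Z2 → Ω → ℝ} {x : Z2} {r : ℤ} (h : HE η F x r)
    (hη : ∀ z, MemLp (η z) 2 (ℙ : Measure Ω))
    (hG : ∀ z ∈ oBox x r, ∀ w, 4 * (∫ ω, η w ω * η z ω) =
      nsum (fun z => ∫ ω, η w ω * η z ω) z + 4 * (if z = w then 1 else 0))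
    (w z : Z2) (hz : z ∈ oBox x r) :
    4 * gB η F w z = nsum (gB η F w) z + 4 * (if z = w then 1 else 0) := by
  have h1 := h.pair hη (hη w) z hz
  have h2 := hG z hz w
  simp only [nsum, gB] at *
  linarith

lemma ite_nn (p : Prop) [Decidable p] : (0 : ℝ) ≤ if p then 1 else 0 := by
  split_ifs <;> norm_num

lemma gB_nonneg {η F : Z2 → Ω → ℝ} {x : Z2} {r : ℤ} (h : HE η F x r)
    (hη : ∀ z, MemLp (η z) 2 (ℙ : Measure Ω))
    (hG : ∀ z ∈ oBox x r, ∀ w, 4 * (∫ ω, η w ω * η z ω) =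
      nsum (fun z => ∫ ω, η w ω * η z ω) z + 4 * (if z = w then 1 else 0))
    (w z : Z2) : 0 ≤ gB η F w z := by
  by_cases hz : z ∈ oBox x r
  · refine box_min x r (gB η F w) ?_ ?_ z (oBox_sub x r hz)
    · intro z hz
      have := gB_in h hη hG w z hz
      have := ite_nn (z = w)
      linarith
    · intro z _ hz
      rw [gB_out h w z hz]
  · rw [gB_out h w z hz]

lemma gB_zero {η F : Z2 → Ω → ℝ} {x : Z2} {r : ℤ} (h : HE η F x r)
    (hη : ∀ z, MemLp (η z) 2 (ℙ : Measure Ω))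
    (hG : ∀ z ∈ oBox x r, ∀ w, 4 * (∫ ω, η w ω * η z ω) =
      nsum (fun z => ∫ ω, η w ω * η z ω) z + 4 * (if z = w then 1 else 0))
    (w z : Z2) (hw : w ∉ oBox x r) : gB η F w z ≤ 0 := by
  by_cases hz : z ∈ oBox x r
  · have := box_min x r (fun z => - gB η F w z) ?_ ?_ z (oBox_sub x r hz)
    · linarith
    · intro z hz
      have := gB_in h hη hG w z hz
      have hzw : z ≠ w := by
        rintro rfl
        exact hw hz
      simp only [hzw, if_false, nsum] at *
      linarith
    · intro z _ hz
      simp [gB_out h w z hz]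
  · rw [gB_out h w z hz]

lemma gB_le {η F : Z2 → Ω → ℝ} {x : Z2} {r : ℤ} (h : HE η F x r)
    (hη : ∀ z, MemLp (η z) 2 (ℙ : Measure Ω))
    (hG : ∀ z ∈ oBox x r, ∀ w, 4 * (∫ ω, η w ω * η z ω) =
      nsum (fun z => ∫ ω, η w ω * η z ω) z + 4 * (if z = w then 1 else 0))
    (M : ℝ) (w : Z2) (hM : ∀ z ∈ cBox x r, qd z w ≤ M) (hM0 : 0 < M) (z : Z2)
    (hz : z ∈ cBox x r) : gB η F w z ≤ barrier M w z := by
  have := box_min x r (fun z => barrier M w z - gB η F w z) ?_ ?_ z hz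
  · linarith
  · intro z hz
    have h1 := gB_in h hη hG w z hz
    have h2 := barrier_super M hM0 w z
    simp only [nsum] at *
    linarith
  · intro z hz hz'
    rw [gB_out h w z hz']
    have := barrier_nonneg M w z (hM z hz)
    linarith

lemma gB_mono {η F F' : Z2 → Ω → ℝ} {x : Z2} {r r' : ℤ} (h : HE η F x r) (h' : HE η F' x r')
    (hr : r ≤ r') (hη : ∀ z, MemLp (η z) 2 (ℙ : Measure Ω))
    (hG : ∀ z ∈ oBox x r', ∀ w, 4 * (∫ ω, η w ω * η z ω) =
      nsum (fun z => ∫ ω, η w ω * η z ω) z + 4 * (if z = w then 1 else 0))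
    (w z : Z2) : gB η F w z ≤ gB η F' w z := by
  have hsub : ∀ z ∈ oBox x r, z ∈ oBox x r' := by
    rintro z ⟨h1, h2, h3, h4⟩
    refine ⟨?_, ?_, ?_, ?_⟩ <;> omega
  by_cases hz : z ∈ oBox x r
  · have := box_min x r (fun z => gB η F' w z - gB η F w z) ?_ ?_ z (oBox_sub x r hz)
    · linarith
    · intro z hz
      have h1 := gB_in h hη (fun z hz => hG z (hsub z hz)) w z hz
      have h2 := gB_in h' hη hG w z (hsub z hz)
      simp only [nsum] at *
      linarith
    · intro z _ hz'
      rw [gB_out h w z hz', sub_zero]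
      exact gB_nonneg h' hη hG w z
  · rw [gB_out h w z hz]
    exact gB_nonneg h' hη hG w z

lemma qd_le_of (z w : Z2) (s : ℤ) (h1 : -s ≤ z.1 - w.1) (h2 : z.1 - w.1 ≤ s)
    (h3 : -s ≤ z.2 - w.2) (h4 : z.2 - w.2 ≤ s) : qd z w ≤ 2 * (s : ℝ) ^ 2 + 1 := by
  have g1 : (-(s : ℝ)) ≤ (z.1 : ℝ) - w.1 := by exact_mod_cast h1
  have g2 : (z.1 : ℝ) - w.1 ≤ s := by exact_mod_cast h2
  have g3 : (-(s : ℝ)) ≤ (z.2 : ℝ) - w.2 := by exact_mod_cast h3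
  have g4 : (z.2 : ℝ) - w.2 ≤ s := by exact_mod_cast h4
  have k1 := sq_le_sq' g1 g2
  have k2 := sq_le_sq' g3 g4
  unfold qd
  linarith

lemma barrier_le_cst (z x : Z2) (b : ℤ) (hb : 0 ≤ b)
    (h : b ≤ 2 * |z.1 - x.1| ∨ b ≤ 2 * |z.2 - x.2|) :
    barrier (18 * (b : ℝ) ^ 2 + 1) x z ≤ cst := by
  have hb' : (0 : ℝ) ≤ b := by exact_mod_cast hb
  have key : (b : ℝ) ^ 2 ≤ 4 * (qd z x - 1) := by
    unfold qd
    rcases h with h | h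
    · have g : (b : ℝ) ≤ 2 * |(z.1 : ℝ) - x.1| := by exact_mod_cast h
      have := pow_le_pow_left₀ hb' g 2
      rw [mul_pow, sq_abs] at this
      nlinarith [sq_nonneg ((z.2 : ℝ) - x.2)]
    · have g : (b : ℝ) ≤ 2 * |(z.2 : ℝ) - x.2| := by exact_mod_cast h
      have := pow_le_pow_left₀ hb' g 2
      rw [mul_pow, sq_abs] at this
      nlinarith [sq_nonneg ((z.1 : ℝ) - x.1)]
  unfold barrier cst
  have hl2 : 0 < Real.log 2 := Real.log_pos (by norm_num)
  apply div_le_div_of_nonneg_right _ hl2.le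
  apply Real.log_le_log
  · have := qd_pos z x
    positivity
  · rw [div_le_iff₀ (qd_pos z x)]
    linarith

lemma core_bound {η Fax Fbx Fay Fby : Z2 → Ω → ℝ} {x y : Z2} {a b : ℤ} (ha : 0 ≤ a) (hab : a ≤ b)
    (hη : ∀ z, MemLp (η z) 2 (ℙ : Measure Ω))
    (hG : ∀ z ∈ oBox x b, ∀ w, 4 * (∫ ω, η w ω * η z ω) =
      nsum (fun z => ∫ ω, η w ω * η z ω) z + 4 * (if z = w then 1 else 0))
    (h1 : HE η Fax x a) (h2 : HE η Fbx x b) (h3 : HE η Fay y a) (h4 : HE η Fby y b) :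
    -cst ≤ ∫ ω, (Fax x - Fbx x) ω * (Fay y - Fby y) ω := by
  have hb : 0 ≤ b := ha.trans hab
  have hcst : 0 ≤ cst := div_nonneg (Real.log_nonneg (by norm_num)) (Real.log_nonneg (by norm_num))
  have hGa : ∀ z ∈ oBox x a, ∀ w, 4 * (∫ ω, η w ω * η z ω) =
      nsum (fun z => ∫ ω, η w ω * η z ω) z + 4 * (if z = w then 1 else 0) := by
    rintro z ⟨e1, e2, e3, e4⟩
    apply hG
    refine ⟨?_, ?_, ?_, ?_⟩ <;> omega
  set u : Ω → ℝ := Fax x - Fbx x with hu_def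
  have mA := h1.memLp hη
  have mB := h2.memLp hη
  have mC := h3.memLp hη
  have mD := h4.memLp hη
  have hu : MemLp u 2 (ℙ : Measure Ω) := (mA x).sub (mB x)
  have hc : ∀ w, ∫ ω, u ω * η w ω = gB η Fbx w x - gB η Fax w x := by
    intro w
    rw [int_comm, hu_def, int_sub (hη w) (mA x) (mB x)]
    unfold gB
    ring
  have hc0 : ∀ w, 0 ≤ ∫ ω, u ω * η w ω := by
    intro w
    rw [hc]
    linarith [gB_mono h1 h2 hab hη hG w x]
  have hcle : ∀ w, ∫ ω, u ω * η w ω ≤ gB η Fbx w x := by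
    intro w
    rw [hc]
    linarith [gB_nonneg h1 hη hGa w x]
  have hcout : ∀ w, w ∉ oBox x b → ∫ ω, u ω * η w ω ≤ 0 := fun w hw =>
    (hcle w).trans (gB_zero h2 hη hG w x hw)
  have yin : ∀ r : ℤ, 0 ≤ r → ∀ y : Z2, y ∈ cBox y r := by
    intro r hr y
    refine ⟨?_, ?_, ?_, ?_⟩ <;> omega
  rw [int_sub hu (mC y) (mD y)]
  have hA : 0 ≤ ∫ ω, u ω * Fay y ω := by
    refine box_min y a (fun z => ∫ ω, u ω * Fay z ω) ?_ ?_ y (yin a ha y)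
    · intro z hz
      exact (h3.pair hη hu z hz).ge
    · intro z _ hz
      simp only [h3.1 z hz]
      exact hc0 z
  -- comparison principle for the second term
  have hmax : ∀ f : Z2 → ℝ, (∀ z ∈ oBox y b, nsum f z ≤ 4 * f z) →
      (∀ z ∈ cBox y b, z ∉ oBox y b → ∫ ω, u ω * η z ω ≤ f z) →
      ∫ ω, u ω * Fby y ω ≤ f y := by
    intro f hf1 hf2
    have := box_min y b (fun z => f z - ∫ ω, u ω * Fby z ω) ?_ ?_ y (yin b hb y)
    · linarith
    · intro z hz
      have e1 := h4.pair hη hu z hz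
      have e2 := hf1 z hz
      simp only [nsum] at *
      linarith
    · intro z hz hz'
      simp only [h4.1 z hz']
      linarith [hf2 z hz hz']
  have hconst : ∀ c : ℝ, ∀ z, nsum (fun _ : Z2 => c) z ≤ 4 * c := by
    intro c z
    simp only [nsum]
    linarith
  suffices hB : ∫ ω, u ω * Fby y ω ≤ cst by linarith
  by_cases hfar : 2 * b ≤ |y.1 - x.1| ∨ 2 * b ≤ |y.2 - x.2|
  · refine (hmax (fun _ => 0) (fun z _ => hconst 0 z) ?_).trans hcst
    rintro z ⟨e1, e2, e3, e4⟩ _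
    apply hcout
    rintro ⟨g1, g2, g3, g4⟩
    rcases hfar with h | h
    · rcases abs_cases (y.1 - x.1) with h' | h' <;> omega
    · rcases abs_cases (y.2 - x.2) with h' | h' <;> omega
  · push Not at hfar
    obtain ⟨f1, f2⟩ := hfar
    rw [abs_lt] at f1 f2
    have hM0 : (0 : ℝ) < 18 * (b : ℝ) ^ 2 + 1 := by positivity
    have h18 : 2 * ((3 * b : ℤ) : ℝ) ^ 2 + 1 = 18 * (b : ℝ) ^ 2 + 1 := by push_cast; ring
    have hbar : ∀ z ∈ cBox y b, ∫ ω, u ω * η z ω ≤ barrier (18 * (b : ℝ) ^ 2 + 1) x z := by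
      rintro z ⟨e1, e2, e3, e4⟩
      by_cases hz : z ∈ oBox x b
      · refine (hcle z).trans ?_
        have : barrier (18 * (b : ℝ) ^ 2 + 1) x z = barrier (18 * (b : ℝ) ^ 2 + 1) z x := by
          unfold barrier
          rw [qd_symm]
        rw [this]
        apply gB_le h2 hη hG _ z _ hM0 x (yin b hb x)
        rintro v ⟨k1, k2, k3, k4⟩
        obtain ⟨g1, g2, g3, g4⟩ := hz
        rw [← h18]
        apply qd_le_of <;> omega
      · refine (hcout z hz).trans (barrier_nonneg _ _ _ ?_)
        rw [← h18]
        apply qd_le_of <;> omega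
    by_cases hmid : b ≤ 2 * |y.1 - x.1| ∨ b ≤ 2 * |y.2 - x.2|
    · refine (hmax (barrier (18 * (b : ℝ) ^ 2 + 1) x) ?_ (fun z hz _ => hbar z hz)).trans
        (barrier_le_cst y x b hb hmid)
      intro z _
      have := barrier_super _ hM0 x z
      have := ite_nn (z = x)
      linarith
    · push Not at hmid
      obtain ⟨m1, m2⟩ := hmid
      have m1' := abs_lt.1 (show |2 * (y.1 - x.1)| < b by rw [abs_mul]; simpa using m1)
      have m2' := abs_lt.1 (show |2 * (y.2 - x.2)| < b by rw [abs_mul]; simpa using m2)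
      refine hmax (fun _ => cst) (fun z _ => hconst cst z) ?_
      intro z hz hz'
      refine (hbar z hz).trans (barrier_le_cst z x b hb ?_)
      simp only [oBox, cBox, Set.mem_ofPred_eq] at hz hz'
      by_contra hcon
      push Not at hcon
      obtain ⟨c1, c2⟩ := hcon
      have c1' := abs_lt.1 (show |2 * (z.1 - x.1)| < b by rw [abs_mul]; simpa using c1)
      have c2' := abs_lt.1 (show |2 * (z.2 - x.2)| < b by rw [abs_mul]; simpa using c2)
      omega

lemma gauss_memLp {ι : Type*} (f : ι → Ω → ℝ) (h : IsCenteredGaussianFamily f) (i : ι) :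
    MemLp (f i) 2 (ℙ : Measure Ω) := by
  obtain ⟨v, hv⟩ := h {i} (fun _ => 1)
  simp only [Finset.sum_singleton, one_mul] at hv
  have hm : AEMeasurable (f i) (ℙ : Measure Ω) := by
    by_contra hm
    have h0 : Measure.map (fun ω => f i ω) (ℙ : Measure Ω) = 0 := Measure.map_of_not_aemeasurable hm
    rw [h0] at hv
    exact IsProbabilityMeasure.ne_zero (gaussianReal 0 v) hv.symm
  have hid : MemLp id 2 (Measure.map (f i) (ℙ : Measure Ω)) := by
    have : Measure.map (f i) (ℙ : Measure Ω) = gaussianReal 0 v := hv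
    rw [this]
    exact memLp_id_gaussianReal 2
  exact (memLp_map_measure_iff hid.1 hm).1 hid

lemma IsHarmExt.toHE {η F : Z2 → Ω → ℝ} {x : Z2} {l : ℤ} (h : IsHarmExt η F (boxZ x l)) :
    HE η F x (l / 2) := by
  unfold IsHarmExt at h
  rw [boxZ_eq, box_diff] at h
  refine ⟨h.1, fun z hz => ?_⟩
  funext ω
  have := h.2 z hz ω
  simpa [nsum] using this

lemma dgff_green {η : Z2 → Ω → ℝ} {N : ℕ} (h : IsDGFF (V5N N) η) (z : Z2) (hz : z ∈ V5N N)
    (hzb : z ∉ bdry (V5N N)) (w : Z2) : 4 * (∫ ω, η w ω * η z ω) =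
      nsum (fun z => ∫ ω, η w ω * η z ω) z + 4 * (if z = w then 1 else 0) := by
  by_cases hw : w ∈ V5N N
  · have hM : ∀ z ∈ V5N N, ∀ w ∈ V5N N, qd z w ≤ 2 * ((5 * N : ℤ) : ℝ) ^ 2 + 1 := by
      rintro z ⟨e1, e2, e3, e4⟩ w ⟨g1, g2, g3, g4⟩
      apply qd_le_of <;> omega
    have hr := green_rec _ _ hM z w hz hw hzb
    have hc : ∀ z ∈ V5N N, ∫ ω, η w ω * η z ω = greenFn (V5N N) z w := by
      intro z hz
      rw [int_comm]
      exact h.2.2 z hz w hw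
    obtain ⟨n1, n2, n3, n4⟩ := nbrIn_of_not_bdry _ z hz hzb
    simp only [nsum] at hr ⊢
    rw [hc z hz, hc _ n1, hc _ n2, hc _ n3, hc _ n4]
    exact hr
  · have h0 : η w = 0 := h.2.1 w hw
    have : z ≠ w := by
      rintro rfl
      exact hw hz
    simp [h0, this, nsum]

end core

lemma cst_pos : 0 < cst := div_pos (Real.log_pos (by norm_num)) (Real.log_pos (by norm_num))

/-- **Lemma 2.1.** There is a universal constant `C₄ > 0` such that the covariances
of all the fields `η_j` are bounded below by `-C₄`: for every `k ≥ 1`, `K = 2^k`,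
`K^m ≤ N < K^{m+1}`, every `0 ≤ j ≤ m-1` and all `x, y ∈ V_N`,
`E[η_j(x) η_j(y)] ≥ -C₄`. -/
theorem etaJ_covariance_lower_bound :
    ∃ C₄ : ℝ, 0 < C₄ ∧
      ∀ k : ℕ, 1 ≤ k → ∀ K : ℕ, K = 2 ^ k →
        ∀ m N : ℕ, K ^ m ≤ N → N < K ^ (m + 1) →
          ∀ (Ω : Type) (_ : MeasureSpace Ω), IsProbabilityMeasure (ℙ : Measure Ω) →
            ∀ η : Z2 → Ω → ℝ, IsDGFF (V5N N) η →
              ∀ H : ℤ → Z2 → Ω → ℝ,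
                (∀ (r : ℕ) (x : Z2), ∃ F : Z2 → Ω → ℝ,
                  IsHarmExt η F (boxZ x ((K : ℤ) ^ r)) ∧ H ((K : ℤ) ^ r) x = F x) →
                ∀ j : ℕ, j < m → ∀ x ∈ VN N, ∀ y ∈ VN N,
                  -C₄ ≤ ∫ ω, etaJ η H K j x ω * etaJ η H K j y ω := by
  refine ⟨cst, cst_pos, ?_⟩
  intro k hk K hK m N hmN _ Ω _ _ η hη H hH j hj x hx y _
  have hL2 := gauss_memLp _ hη.1
  have heta : ∀ x, etaJ η H K j x = H ((K : ℤ) ^ j) x - H ((K : ℤ) ^ (j + 1)) x := by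
    intro x
    unfold etaJ
    split_ifs with h
    · subst h
      obtain ⟨F, hF, hFx⟩ := hH 0 x
      have h0 : H ((K : ℤ) ^ 0) x = η x := by
        rw [hFx]
        apply hF.toHE.1
        rintro ⟨h1, h2, _⟩
        norm_num at h1
      rw [h0]
      funext ω
      simp
    · rfl
  rw [heta x, heta y]
  have hK2 : 2 ≤ K := by
    rw [hK]
    calc 2 = 2 ^ 1 := by norm_num
      _ ≤ 2 ^ k := Nat.pow_le_pow_right (by norm_num) hk
  have hKN : (K : ℤ) ^ (j + 1) ≤ N := by
    have : K ^ (j + 1) ≤ N := (Nat.pow_le_pow_right (by omega) hj).trans hmN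
    exact_mod_cast this
  have hpos : (0 : ℤ) ≤ (K : ℤ) ^ j := by positivity
  have hmono : (K : ℤ) ^ j ≤ (K : ℤ) ^ (j + 1) := by
    have : K ^ j ≤ K ^ (j + 1) := Nat.pow_le_pow_right (by omega) (by omega)
    exact_mod_cast this
  have hN : 0 < N := by
    obtain ⟨h1, h2, _⟩ := hx
    omega
  obtain ⟨F1, hF1, e1⟩ := hH j x
  obtain ⟨F2, hF2, e2⟩ := hH (j + 1) x
  obtain ⟨F3, hF3, e3⟩ := hH j y
  obtain ⟨F4, hF4, e4⟩ := hH (j + 1) y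
  rw [e1, e2, e3, e4]
  refine core_bound (a := (K : ℤ) ^ j / 2) (b := (K : ℤ) ^ (j + 1) / 2) (by omega) (by omega) hL2 ?_
    hF1.toHE hF2.toHE hF3.toHE hF4.toHE
  rintro z ⟨g1, g2, g3, g4⟩ w
  obtain ⟨k1, k2, k3, k4⟩ := hx
  have hb : (K : ℤ) ^ (j + 1) / 2 ≤ N := by omega
  generalize (K : ℤ) ^ (j + 1) / 2 = b at *
  refine dgff_green hη z ⟨by omega, by omega, by omega, by omega⟩ ?_ w
  rintro ⟨_, v, hv, hv'⟩
  obtain ⟨i, rfl⟩ := (adj_iff _ _).1 hv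
  apply hv'
  fin_cases i <;> refine ⟨?_, ?_, ?_, ?_⟩ <;> simp [nb] <;> omega
end

section
/- Let δ, κ ∈ (0,1), K = 2^k ≥ 4, and K^m ≤ N < K^{m+1}. Let T be a finite rooted tree of depth m with all leaves at depth m, where each node u at depth 1 ≤ L(u) ≤ m−1 carries a positive real ‖u‖ and is marked either tame or untame, and d_u denotes the number of children of u. Assume: (i) the root degree satisfies d_ρ ≥ κK/2; (ii) every depth-1 node u satisfies ‖u‖ ≥ K^{m−1}; (iii) for every node u with 1 ≤ L(u) ≤ m−2, every child v of u satisfies ‖v‖ ≥ ‖u‖/d_u, and ‖v‖ ≥ (1 + 1/K²)·‖u‖/d_u if u is marked untame; (iv) every node u with L(u) = m−1 satisfies d_u ≥ ‖u‖/2; (v) the number of leaves of T is at most N^{1 + δ/(K²k)}. Then, for all sufficiently large m (depending on κ, δ, K), the unit uniform flow θ on T satisfies ∑_{u : 1 ≤ L(u) ≤ m−1} θ(u)·1{u is marked untame} ≤ 2δm. -/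
open MeasureTheory ProbabilityTheory Real Set Filter

/-- A finite rooted tree is encoded as a finite, prefix-closed set of finite
sequences of natural numbers; the root is the empty sequence, the children of a
node `u` are the nodes of the form `u ++ [i]`, and the depth `L(u)` of a node is
its length. -/
def PrefixClosed (T : Finset (List ℕ)) : Prop := ∀ l ∈ T, ∀ p, p <+: l → p ∈ T

/-- The number `d_u` of children of the node `u` in the tree `T`. -/
def degT (T : Finset (List ℕ)) (u : List ℕ) : ℕ :=
  (T.filter (fun l => u <+: l ∧ l.length = u.length + 1)).card

/-- A node is a leaf if it has no children. -/
def IsLeaf (T : Finset (List ℕ)) (u : List ℕ) : Prop := degT T u = 0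

/-- The unit uniform flow `θ` on the tree `T`: `θ(root) = 1` and
`θ(v) = θ(u) / d_u` whenever `v` is a child of the node `u` with `d_u` children. -/
noncomputable def flowT (T : Finset (List ℕ)) (u : List ℕ) : ℝ :=
  ∏ r ∈ Finset.range u.length, ((degT T (u.take r) : ℝ))⁻¹

/-- A finite rooted tree of depth `m` all of whose leaves are at depth `m`. -/
def IsUniformDepthTree (T : Finset (List ℕ)) (m : ℕ) : Prop :=
  ([] : List ℕ) ∈ T ∧ PrefixClosed T ∧ (∀ l ∈ T, l.length ≤ m) ∧
    (∀ l ∈ T, l.length < m → ∃ i, l ++ [i] ∈ T)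


lemma deg_pos {T : Finset (List ℕ)} {m : ℕ} (hT : IsUniformDepthTree T m) {u : List ℕ}
    (hu : u ∈ T) (hm : u.length < m) : 0 < degT T u := by
  obtain ⟨i, hi⟩ := hT.2.2.2 u hu hm
  unfold degT
  apply Finset.card_pos.mpr
  exact ⟨u ++ [i], by simp [hi]⟩

lemma take_mem {T : Finset (List ℕ)} {m : ℕ} (hT : IsUniformDepthTree T m) {u : List ℕ}
    (hu : u ∈ T) (r : ℕ) : u.take r ∈ T :=
  hT.2.1 u hu _ (List.take_prefix r u)

lemma flow_pos {T : Finset (List ℕ)} {m : ℕ} (hT : IsUniformDepthTree T m) {u : List ℕ}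
    (hu : u ∈ T) : 0 < flowT T u := by
  unfold flowT
  apply Finset.prod_pos
  intro r hr
  have h1 := Finset.mem_range.mp hr
  have h2 := hT.2.2.1 u hu
  have : 0 < degT T (u.take r) := deg_pos hT (take_mem hT hu r) (by simp; omega)
  positivity

lemma flow_succ (T : Finset (List ℕ)) {v : List ℕ} {j : ℕ} (hv : v.length = j + 1) :
    flowT T v = flowT T (v.take j) * ((degT T (v.take j) : ℝ))⁻¹ := by
  unfold flowT
  rw [hv, Finset.prod_range_succ]
  have : (v.take j).length = j := by simp; omega
  rw [this]
  congr 1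
  apply Finset.prod_congr rfl
  intro r hr
  have := Finset.mem_range.mp hr
  rw [List.take_take, min_eq_left (by omega)]

lemma level_step {T : Finset (List ℕ)} {m : ℕ} (hT : IsUniformDepthTree T m) {j : ℕ}
    (hj : j < m) (g : List ℕ → ℝ) :
    ∑ v ∈ T.filter (fun l => l.length = j + 1), flowT T v * g (v.take j)
      = ∑ u ∈ T.filter (fun l => l.length = j), flowT T u * g u := by
  rw [← Finset.sum_fiberwise_of_maps_to (t := T.filter (fun l => l.length = j))
    (g := fun v : List ℕ => v.take j)]
  · apply Finset.sum_congr rfl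
    intro u hu
    obtain ⟨huT, hul⟩ := Finset.mem_filter.mp hu
    have hd : 0 < degT T u := deg_pos hT huT (by omega)
    have hset : (T.filter (fun l => l.length = j + 1)).filter (fun v => v.take j = u)
        = T.filter (fun l => u <+: l ∧ l.length = u.length + 1) := by
      ext l
      simp only [Finset.mem_filter]
      constructor
      · rintro ⟨⟨h1, h2⟩, h3⟩
        exact ⟨h1, h3 ▸ List.take_prefix j l, by omega⟩
      · rintro ⟨h1, h2, h3⟩
        refine ⟨⟨h1, by omega⟩, ?_⟩
        rw [← hul]; exact (List.prefix_iff_eq_take.mp h2).symm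
    have hc : ∀ v ∈ (T.filter (fun l => l.length = j + 1)).filter (fun v => v.take j = u),
        flowT T v * g (v.take j) = flowT T u * (degT T u : ℝ)⁻¹ * g u := by
      intro v hv
      simp only [Finset.mem_filter] at hv
      rw [flow_succ T hv.1.2, hv.2]
    rw [Finset.sum_congr rfl hc, Finset.sum_const, hset]
    change degT T u • _ = _
    rw [nsmul_eq_mul]
    field_simp
  · intro v hv
    obtain ⟨h1, h2⟩ := Finset.mem_filter.mp hv
    exact Finset.mem_filter.mpr ⟨take_mem hT h1 j, by simp; omega⟩

lemma level_sum {T : Finset (List ℕ)} {m : ℕ} (hT : IsUniformDepthTree T m) {r : ℕ}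
    (f : List ℕ → ℝ) (n : ℕ) (hn : r + n ≤ m) :
    ∑ v ∈ T.filter (fun l => l.length = r + n), flowT T v * f (v.take r)
      = ∑ u ∈ T.filter (fun l => l.length = r), flowT T u * f u := by
  induction n with
  | zero =>
    apply Finset.sum_congr rfl
    intro u hu
    rw [List.take_of_length_le (by have := (Finset.mem_filter.mp hu).2; omega)]
  | succ n ih =>
    rw [← ih (by omega), ← level_step hT (by omega : r + n < m) (fun l => f (l.take r))]
    apply Finset.sum_congr (by rfl)
    intro v hv
    rw [List.take_take, min_eq_left (by omega)]

lemma level_one {T : Finset (List ℕ)} {m : ℕ} (hT : IsUniformDepthTree T m) {r : ℕ}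
    (hr : r ≤ m) : ∑ v ∈ T.filter (fun l => l.length = r), flowT T v = 1 := by
  have h := level_sum hT (r := 0) (fun _ => 1) r (by omega)
  simp only [mul_one, zero_add] at h
  rw [h]
  have : T.filter (fun l => l.length = 0) = {[]} := by
    ext l
    simp only [Finset.mem_filter, Finset.mem_singleton, List.length_eq_zero_iff]
    constructor
    · exact fun h => h.2
    · rintro rfl; exact ⟨hT.1, rfl⟩
  rw [this]; simp [flowT]

/-- indicator of untame nodes -/
noncomputable def ind (untame : List ℕ → Bool) (u : List ℕ) : ℝ := if untame u = true then 1 else 0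

/-- number of untame strict ancestors (other than the root) -/
noncomputable def cnt (untame : List ℕ → Bool) (u : List ℕ) : ℝ :=
  ∑ r ∈ Finset.Ico 1 u.length, ind untame (u.take r)

lemma path_bound {T : Finset (List ℕ)} {m : ℕ} (hT : IsUniformDepthTree T m)
    (nrm : List ℕ → ℝ) (untame : List ℕ → Bool) (K : ℕ) (hK : 4 ≤ K) (A : ℝ) (hA : 0 < A)
    (hpos : ∀ u ∈ T, 1 ≤ u.length → u.length + 1 ≤ m → 0 < nrm u)
    (hroot : A ≤ (degT T ([] : List ℕ) : ℝ))
    (h1 : ∀ u ∈ T, u.length = 1 → (K : ℝ) ^ (m - 1) ≤ nrm u)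
    (h2 : ∀ u ∈ T, 1 ≤ u.length → u.length + 2 ≤ m →
                ∀ i : ℕ, u ++ [i] ∈ T →
                  nrm u / (degT T u : ℝ) ≤ nrm (u ++ [i]) ∧
                  (untame u = true →
                    (1 + 1 / (K : ℝ) ^ 2) * nrm u / (degT T u : ℝ) ≤ nrm (u ++ [i])))
    (j : ℕ) : ∀ u ∈ T, u.length = j + 1 → j + 2 ≤ m →
      log A + log ((K : ℝ) ^ (m - 1)) + log (1 + 1 / (K : ℝ) ^ 2) * cnt untame u
        ≤ - log (flowT T u) + log (nrm u) := by
  have hK0 : (0 : ℝ) < K := by exact_mod_cast (by omega : 0 < K)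
  induction j with
  | zero =>
    intro u hu hl hm
    have hc : cnt untame u = 0 := by simp [cnt, hl]
    have hf : flowT T u = ((degT T ([] : List ℕ) : ℝ))⁻¹ := by simp [flowT, hl]
    rw [hc, hf, Real.log_inv]
    have a := Real.log_le_log hA hroot
    have b := Real.log_le_log (by positivity) (h1 u hu (by omega))
    linarith
  | succ j ih =>
    intro v hv hl hm
    set u := v.take (j + 1) with hu
    have huT : u ∈ T := take_mem hT hv _
    have hul : u.length = j + 1 := by simp [hu]; omega
    have ihu := ih u huT hul (by omega)
    have hvu : v = u ++ [v[j + 1]] := by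
      rw [hu, List.take_append_getElem, List.take_of_length_le (by omega)]
    have hd : (0 : ℝ) < degT T u := by exact_mod_cast deg_pos hT huT (by omega)
    have hfu := flow_pos hT huT
    have hnu := hpos u huT (by omega) (by omega)
    have hc : cnt untame v = cnt untame u + ind untame u := by
      unfold cnt
      rw [hl, hul, Finset.sum_Ico_succ_top (by omega)]
      congr 1
      apply Finset.sum_congr rfl
      intro r hr
      have := (Finset.mem_Ico.mp hr).2
      rw [hu, List.take_take, min_eq_left (by omega)]
    have hf : log (flowT T v) = log (flowT T u) - log (degT T u : ℝ) := by
      rw [flow_succ T hl, Real.log_mul (by positivity) (by positivity), Real.log_inv]; ring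
    obtain ⟨ha, hb⟩ := h2 u huT (by omega) (by omega) _ (hvu ▸ hv)
    rw [← hvu] at ha hb
    have key : log (nrm u) - log (degT T u : ℝ) + log (1 + 1 / (K : ℝ) ^ 2) * ind untame u
        ≤ log (nrm v) := by
      unfold ind
      split_ifs with h
      · have := Real.log_le_log (by positivity) (hb h)
        rw [Real.log_div (by positivity) (by positivity),
          Real.log_mul (by positivity) (by positivity)] at this
        linarith
      · have := Real.log_le_log (by positivity) ha
        rw [Real.log_div (by positivity) (by positivity)] at this
        linarith
    rw [hc, hf]
    linarith

lemma entropy_le {ι : Type*} (s : Finset ι) (θ : ι → ℝ) (hp : ∀ i ∈ s, 0 < θ i)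
    (h1 : ∑ i ∈ s, θ i = 1) : ∑ i ∈ s, θ i * (- log (θ i)) ≤ log (s.card : ℝ) := by
  have hne : s.Nonempty := by
    by_contra h
    rw [Finset.not_nonempty_iff_eq_empty] at h
    simp [h] at h1
  have hc : (0 : ℝ) < s.card := by exact_mod_cast hne.card_pos
  have : ∀ i ∈ s, θ i * (- log (θ i)) ≤ θ i * log (s.card : ℝ) + ((s.card : ℝ)⁻¹ - θ i) := by
    intro i hi
    have hpi := hp i hi
    have h := Real.log_le_sub_one_of_pos (show 0 < (θ i * s.card)⁻¹ by positivity)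
    rw [Real.log_inv, Real.log_mul (by positivity) (by positivity)] at h
    have h' := mul_le_mul_of_nonneg_left h hpi.le
    have e : θ i * ((θ i * (s.card : ℝ))⁻¹ - 1) = (s.card : ℝ)⁻¹ - θ i := by field_simp
    rw [e] at h'
    linarith
  have h := Finset.sum_le_sum this
  rw [Finset.sum_add_distrib, ← Finset.sum_mul, Finset.sum_sub_distrib, h1, Finset.sum_const,
    nsmul_eq_mul, mul_inv_cancel₀ hc.ne'] at h
  linarith

lemma untame_sum {T : Finset (List ℕ)} {m : ℕ} (hT : IsUniformDepthTree T m) (hm : 2 ≤ m)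
    (untame : List ℕ → Bool) :
    ∑ u ∈ T.filter (fun u => 1 ≤ u.length ∧ u.length + 1 ≤ m ∧ untame u = true), flowT T u
      ≤ ∑ v ∈ T.filter (fun l => l.length = m), flowT T v * cnt untame (v.take (m - 1)) + 1 := by
  have e1 : ∑ u ∈ T.filter (fun u => 1 ≤ u.length ∧ u.length + 1 ≤ m ∧ untame u = true), flowT T u
      = ∑ r ∈ Finset.Ico 1 m, ∑ u ∈ T.filter (fun l => l.length = r), flowT T u * ind untame u := by
    rw [← Finset.sum_fiberwise_of_maps_to (t := Finset.Ico 1 m) (g := List.length)]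
    · apply Finset.sum_congr rfl
      intro r hr
      have := Finset.mem_Ico.mp hr
      simp only [ind, mul_ite, mul_one, mul_zero]
      rw [← Finset.sum_filter, Finset.filter_filter, Finset.filter_filter]
      apply Finset.sum_congr _ (fun _ _ => rfl)
      ext l
      simp only [Finset.mem_filter]
      constructor
      · rintro ⟨a, ⟨b, c, d⟩, e⟩; exact ⟨a, e, d⟩
      · rintro ⟨a, b, c⟩; exact ⟨a, ⟨by omega, by omega, c⟩, b⟩
    · intro u hu
      have := (Finset.mem_filter.mp hu).2
      exact Finset.mem_Ico.mpr ⟨this.1, by omega⟩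
  have e2 : ∑ v ∈ T.filter (fun l => l.length = m), flowT T v * cnt untame (v.take (m - 1))
      = ∑ r ∈ Finset.Ico 1 (m - 1),
          ∑ u ∈ T.filter (fun l => l.length = r), flowT T u * ind untame u := by
    have : ∀ v ∈ T.filter (fun l => l.length = m), flowT T v * cnt untame (v.take (m - 1))
        = ∑ r ∈ Finset.Ico 1 (m - 1), flowT T v * ind untame (v.take r) := by
      intro v hv
      have hl := (Finset.mem_filter.mp hv).2
      have hl2 : (v.take (m - 1)).length = m - 1 := by simp; omega
      rw [cnt, hl2, Finset.mul_sum]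
      apply Finset.sum_congr rfl
      intro r hr
      have := (Finset.mem_Ico.mp hr).2
      rw [List.take_take, min_eq_left (by omega)]
    rw [Finset.sum_congr rfl this, Finset.sum_comm]
    apply Finset.sum_congr rfl
    intro r hr
    have := (Finset.mem_Ico.mp hr).2
    have h := level_sum hT (r := r) (ind untame) (m - r) (by omega)
    rw [show r + (m - r) = m by omega] at h
    exact h
  have e3 : ∑ u ∈ T.filter (fun l => l.length = m - 1), flowT T u * ind untame u ≤ 1 := by
    rw [← level_one hT (show m - 1 ≤ m by omega)]
    apply Finset.sum_le_sum
    intro u hu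
    have := flow_pos hT (Finset.mem_filter.mp hu).1
    unfold ind
    split_ifs <;> linarith
  obtain ⟨n, rfl⟩ : ∃ n, m = n + 1 := ⟨m - 1, by omega⟩
  rw [e1, e2, Finset.sum_Ico_succ_top (by omega)]
  simp only [Nat.add_sub_cancel] at e3 ⊢
  linarith

/-- **Proposition 3.4 (total flow through untame nodes).** Let `δ, κ ∈ (0,1)` and
`K = 2^k ≥ 4`. For all sufficiently large `m` (depending on `κ, δ, K`), for
`K^m ≤ N < K^{m+1}` and every depth-`m` tree `T` (all leaves at depth `m`) whose
nodes `u` with `1 ≤ L(u) ≤ m-1` carry positive reals `‖u‖` and tame/untame marks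
satisfying: root degree `≥ κK/2`; `‖u‖ ≥ K^{m-1}` at depth 1; `‖v‖ ≥ ‖u‖/d_u` for
children `v` of `u` when `1 ≤ L(u) ≤ m-2`, improved to `(1+1/K²)‖u‖/d_u` at untame
`u`; `d_u ≥ ‖u‖/2` at depth `m-1`; and at most `N^{1+δ/(K²k)}` leaves — the unit
uniform flow satisfies `∑_{1 ≤ L(u) ≤ m-1, u untame} θ(u) ≤ 2δm`. -/
theorem flow_through_untame_nodes :
    ∀ δ κ : ℝ, 0 < δ → δ < 1 → 0 < κ → κ < 1 →
      ∀ k K : ℕ, K = 2 ^ k → 4 ≤ K →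
        ∃ m₀ : ℕ, ∀ m : ℕ, m₀ ≤ m →
          ∀ N : ℕ, K ^ m ≤ N → N < K ^ (m + 1) →
            ∀ (T : Finset (List ℕ)) (nrm : List ℕ → ℝ) (untame : List ℕ → Bool),
              IsUniformDepthTree T m →
              (∀ u ∈ T, 1 ≤ u.length → u.length + 1 ≤ m → 0 < nrm u) →
              κ * K / 2 ≤ (degT T ([] : List ℕ) : ℝ) →
              (∀ u ∈ T, u.length = 1 → (K : ℝ) ^ (m - 1) ≤ nrm u) →
              (∀ u ∈ T, 1 ≤ u.length → u.length + 2 ≤ m →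
                ∀ i : ℕ, u ++ [i] ∈ T →
                  nrm u / (degT T u : ℝ) ≤ nrm (u ++ [i]) ∧
                  (untame u = true →
                    (1 + 1 / (K : ℝ) ^ 2) * nrm u / (degT T u : ℝ) ≤ nrm (u ++ [i]))) →
              (∀ u ∈ T, u.length + 1 = m → nrm u / 2 ≤ (degT T u : ℝ)) →
              ((T.filter (fun l => l.length = m)).card : ℝ) ≤
                (N : ℝ) ^ ((1 : ℝ) + δ / ((K : ℝ) ^ 2 * (k : ℝ))) →
              ∑ u ∈ T.filter
                  (fun u => 1 ≤ u.length ∧ u.length + 1 ≤ m ∧ untame u = true),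
                flowT T u ≤ 2 * δ * m := by
  intro δ κ hδ hδ1 hκ hκ1 k K hKk hK
  have hK4 : (4 : ℝ) ≤ K := by exact_mod_cast hK
  have hK0 : (0 : ℝ) < K := by linarith
  have hk : 0 < k := by
    rcases Nat.eq_zero_or_pos k with h | h
    · subst h; simp at hKk; omega
    · exact h
  have hk0 : (0 : ℝ) < k := by exact_mod_cast hk
  have hl2 : 0 < log 2 := Real.log_pos (by norm_num)
  have hlK : log (K : ℝ) = k * log 2 := by rw [hKk]; push_cast; rw [Real.log_pow]
  have hc : log 2 / (K : ℝ) ^ 2 ≤ log (1 + 1 / (K : ℝ) ^ 2) := by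
    have hx : 1 / (K : ℝ) ^ 2 ≤ 1 / 16 := by
      apply one_div_le_one_div_of_le (by norm_num); nlinarith
    have hx0 : 0 < 1 / (K : ℝ) ^ 2 := by positivity
    rw [div_eq_mul_one_div]
    generalize 1 / (K : ℝ) ^ 2 = x at hx hx0 ⊢
    have h := Real.one_sub_inv_le_log_of_pos (show 0 < 1 + x by linarith)
    refine le_trans ?_ h
    have e : 1 - (1 + x)⁻¹ = x / (1 + x) := by field_simp; ring
    rw [e, le_div_iff₀ (by linarith)]
    have := Real.log_two_lt_d9
    nlinarith [mul_pos hl2 hx0]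
  set A := κ * K / 2 with hA
  have hA0 : 0 < A := by positivity
  set C := 2 * log (K : ℝ) - log A + log 2 with hC
  refine ⟨max 2 ⌈(1 + δ + C * (K : ℝ) ^ 2 / log 2) / δ⌉₊, ?_⟩
  intro m hm N hN1 hN2 T nrm untame hT hpos hroot h1 h2 h3 h4
  have hm2 : 2 ≤ m := le_trans (le_max_left _ _) hm
  have hmbig : 1 + δ + C * (K : ℝ) ^ 2 / log 2 ≤ m * δ := by
    rw [← div_le_iff₀ hδ]
    exact (Nat.le_ceil _).trans (by exact_mod_cast le_trans (le_max_right _ _) hm)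
  refine (untame_sum hT hm2 untame).trans ?_
  set EX := ∑ v ∈ T.filter (fun l => l.length = m), flowT T v * cnt untame (v.take (m - 1))
    with hEX
  set c := log (1 + 1 / (K : ℝ) ^ 2) with hcdef
  have hleaf : ∀ v ∈ T.filter (fun l => l.length = m),
      flowT T v * (log A + log ((K : ℝ) ^ (m - 1)) - log 2)
        + c * (flowT T v * cnt untame (v.take (m - 1))) ≤ flowT T v * (- log (flowT T v)) := by
    intro v hv
    obtain ⟨hvT, hvl⟩ := Finset.mem_filter.mp hv
    have huT : v.take (m - 1) ∈ T := take_mem hT hvT _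
    have hul : (v.take (m - 1)).length = m - 1 := by simp; omega
    have hp := path_bound hT nrm untame K hK A hA0 hpos hroot h1 h2 (m - 2) _ huT
      (by omega) (by omega)
    have hfl := flow_succ T (show v.length = (m - 1) + 1 by omega)
    have hd := h3 _ huT (by omega)
    have hn := hpos _ huT (by omega) (by omega)
    have hfu := flow_pos hT huT
    have hdp : (0 : ℝ) < degT T (v.take (m - 1)) := by
      exact_mod_cast deg_pos hT huT (by omega)
    have hld := Real.log_le_log (by positivity) hd
    rw [Real.log_div (by positivity) (by positivity)] at hld
    have hlf : log (flowT T v) = log (flowT T (v.take (m - 1)))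
        - log (degT T (v.take (m - 1)) : ℝ) := by
      rw [hfl, Real.log_mul (by positivity) (by positivity), Real.log_inv]; ring
    have hmain : log A + log ((K : ℝ) ^ (m - 1)) - log 2 + c * cnt untame (v.take (m - 1))
        ≤ - log (flowT T v) := by rw [hlf]; linarith
    have := mul_le_mul_of_nonneg_left hmain (flow_pos hT hvT).le
    linarith
  have hone := level_one hT (le_refl m)
  have hsum := Finset.sum_le_sum hleaf
  rw [Finset.sum_add_distrib, ← Finset.sum_mul, ← Finset.mul_sum, hone, ← hEX] at hsum
  have hent := entropy_le (T.filter (fun l => l.length = m)) (flowT T)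
    (fun i hi => flow_pos hT (Finset.mem_filter.mp hi).1) hone
  have hcard : (0 : ℝ) < (T.filter (fun l => l.length = m)).card := by
    have : (T.filter (fun l => l.length = m)).Nonempty := by
      by_contra h
      rw [Finset.not_nonempty_iff_eq_empty] at h
      simp [h] at hone
    exact_mod_cast this.card_pos
  have hN0 : (0 : ℝ) < N := by
    have : 0 < K ^ m := by positivity
    exact_mod_cast lt_of_lt_of_le this hN1
  have hlc := Real.log_le_log hcard h4
  rw [Real.log_rpow hN0] at hlc
  have hlN : log (N : ℝ) ≤ (m + 1) * log (K : ℝ) := by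
    have : (N : ℝ) ≤ (K : ℝ) ^ (m + 1) := by exact_mod_cast hN2.le
    have := Real.log_le_log hN0 this
    rw [Real.log_pow] at this
    exact_mod_cast this
  have ha : 0 < 1 + δ / ((K : ℝ) ^ 2 * (k : ℝ)) := by positivity
  have hlc2 := hlc.trans (mul_le_mul_of_nonneg_left hlN ha.le)
  have e : (1 + δ / ((K : ℝ) ^ 2 * (k : ℝ))) * ((m + 1) * log (K : ℝ))
      = (m + 1) * log (K : ℝ) + δ * (m + 1) * (log 2 / (K : ℝ) ^ 2) := by
    rw [hlK]; field_simp
  rw [e] at hlc2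
  have e2 : log ((K : ℝ) ^ (m - 1)) = (m - 1) * log (K : ℝ) := by
    rw [Real.log_pow]; push_cast [Nat.cast_sub (show 1 ≤ m by omega)]; ring
  rw [e2] at hsum
  have hEX0 : 0 ≤ EX := by
    apply Finset.sum_nonneg
    intro v hv
    apply mul_nonneg (flow_pos hT (Finset.mem_filter.mp hv).1).le
    apply Finset.sum_nonneg
    intro r _
    unfold ind
    split_ifs <;> norm_num
  have hb : (log 2 / (K : ℝ) ^ 2) * EX ≤ δ * (m + 1) * (log 2 / (K : ℝ) ^ 2) + C := by
    have := mul_le_mul_of_nonneg_right hc hEX0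
    linarith
  have hq : 0 < log 2 / (K : ℝ) ^ 2 := by positivity
  have hfin : EX ≤ δ * (m + 1) + C * (K : ℝ) ^ 2 / log 2 := by
    refine le_of_mul_le_mul_left (hb.trans (le_of_eq ?_)) hq
    field_simp
  linarith
end
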